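/- Let 𝒜 be a skeletally small abelian category and let X be a subobject bicomplete object of 𝒜. Then there exists a composition series of X. Moreover, for any pre-subobject chain Δ of X: (1) Δ is a composition series of X if and only if Δ is not a proper subset of any larger totally ordered set of subobjects of X (i.e., Δ admits no proper refinement); (2) there exists a composition series Δ' of X with Δ ⊆ Δ'. -/

import Mathlib

open CategoryTheory CategoryTheory.Limits

universe w v u

namespace JHS

variable {𝒜 : Type u} [Category.{v} 𝒜] [Abelian 𝒜]

variable {X : 𝒜}

/-- The diagram in `𝒜` associated to a set of subobjects of `X`, given by the underlying
objects and the canonical inclusion monomorphisms between them. -/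
@[simps]
noncomputable def chainDiagram (Δ : Set (Subobject X)) : Δ ⥤ 𝒜 where
  obj Y := (Y.1 : 𝒜)
  map {Y Z} f := Subobject.ofLE Y.1 Z.1 (leOfHom f)
  map_id Y := Subobject.ofLE_refl Y.1
  map_comp {Y Z W} f g := (Subobject.ofLE_comp_ofLE Y.1 Z.1 W.1 (leOfHom f) (leOfHom g)).symm

/-- The cocone over the diagram of a set of subobjects of `X` with vertex an upper bound. -/
@[simps]
noncomputable def chainCocone (Δ : Set (Subobject X)) (W : Subobject X) (h : ∀ Y ∈ Δ, Y ≤ W) :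
    Cocone (chainDiagram Δ) where
  pt := (W : 𝒜)
  ι :=
    { app := fun Y => Subobject.ofLE Y.1 W (h Y.1 Y.2)
      naturality := fun Y Z f => by
        simp [chainDiagram, Subobject.ofLE_comp_ofLE] }

/-- The cone over the diagram of a set of subobjects of `X` with vertex a lower bound. -/
@[simps]
noncomputable def chainCone (Δ : Set (Subobject X)) (W : Subobject X) (h : ∀ Y ∈ Δ, W ≤ Y) :
    Cone (chainDiagram Δ) where
  pt := (W : 𝒜)
  π :=
    { app := fun Y => Subobject.ofLE W Y.1 (h Y.1 Y.2)
      naturality := fun Y Z f => by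
        simp [chainDiagram, Subobject.ofLE_comp_ofLE] }

/-- `W` is the colimit of the chain `Δ` of subobjects of `X`, as a subobject of `X`:
the colimit of the diagram of inclusions exists and the induced morphism to `X` is a
monomorphism with image `W`.  Equivalently, the canonical cocone with vertex `W` is a
colimit cocone. -/
def IsColimSub (Δ : Set (Subobject X)) (W : Subobject X) : Prop :=
  ∃ h : ∀ Y ∈ Δ, Y ≤ W, Nonempty (IsColimit (chainCocone Δ W h))

/-- `W` is the limit of the chain `Δ` of subobjects of `X` (such a limit is automatically a
subobject of `X`): the canonical cone with vertex `W` is a limit cone. -/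
def IsLimSub (Δ : Set (Subobject X)) (W : Subobject X) : Prop :=
  ∃ h : ∀ Y ∈ Δ, W ≤ Y, Nonempty (IsLimit (chainCone Δ W h))

/-- A pre-subobject chain: a set of subobjects totally ordered under inclusion. -/
def IsPreChain (Δ : Set (Subobject X)) : Prop :=
  IsChain (· ≤ ·) Δ

/-- A subobject chain: a pre-subobject chain containing `⊥ = 0` and `⊤ = X`. -/
def IsSubChain (Δ : Set (Subobject X)) : Prop :=
  IsPreChain Δ ∧ ⊥ ∈ Δ ∧ ⊤ ∈ Δ

/-- A chain is cocomplete if every subset has a colimit which is a subobject of `X` and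
lies in the chain. -/
def Cocomplete (Δ : Set (Subobject X)) : Prop :=
  ∀ Δ' ⊆ Δ, ∃ W ∈ Δ, IsColimSub Δ' W

/-- A chain is complete if every subset has a limit which lies in the chain. -/
def Complete (Δ : Set (Subobject X)) : Prop :=
  ∀ Δ' ⊆ Δ, ∃ W ∈ Δ, IsLimSub Δ' W

/-- A chain is bicomplete if it is both cocomplete and complete. -/
def Bicomplete (Δ : Set (Subobject X)) : Prop :=
  Cocomplete Δ ∧ Complete Δ

/-- `W = Y⁻_Δ` is the predecessor of `Y` in `Δ`: the colimit of `{Z ∈ Δ | Z ⊊ Y}`,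
with the convention `0⁻_Δ = 0`. -/
def IsPred (Δ : Set (Subobject X)) (Y W : Subobject X) : Prop :=
  (Y = ⊥ ∧ W = ⊥) ∨ (Y ≠ ⊥ ∧ IsColimSub {Z | Z ∈ Δ ∧ Z < Y} W)

/-- `W = Y⁺_Δ` is the successor of `Y` in `Δ`: the limit of `{Z ∈ Δ | Y ⊊ Z}`,
with the convention `X⁺_Δ = X`. -/
def IsSucc (Δ : Set (Subobject X)) (Y W : Subobject X) : Prop :=
  (Y = ⊤ ∧ W = ⊤) ∨ (Y ≠ ⊤ ∧ IsLimSub {Z | Z ∈ Δ ∧ Y < Z} W)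

/-- The quotient (subfactor) `Y/W` of two nested subobjects of `X`: the cokernel of the
inclusion `W → Y`. -/
noncomputable def quot (W Y : Subobject X) (h : W ≤ Y) : 𝒜 :=
  cokernel (Subobject.ofLE W Y h)

/-- A composition series of `X`: a bicomplete subobject chain all of whose subfactors
`Y/Y⁻_Δ` (for `Y ∈ Δ` with `Y ≠ Y⁻_Δ`) are simple. -/
def IsCompSeries (Δ : Set (Subobject X)) : Prop :=
  IsSubChain Δ ∧ Bicomplete Δ ∧
    ∀ Y ∈ Δ, ∀ (W) (h : W ≤ Y), IsPred Δ Y W → W ≠ Y → Simple (quot W Y h)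

variable (X) in
/-- Axiom (JHS1): `X` is subobject cocomplete. -/
def JHS1 : Prop :=
  ∀ Δ : Set (Subobject X), IsPreChain Δ → ∃ W, IsColimSub Δ W

variable (X) in
/-- Axiom (JHS2): `X` is subobject complete. -/
def JHS2 : Prop :=
  ∀ Δ : Set (Subobject X), IsPreChain Δ → ∃ W, IsLimSub Δ W

variable (X) in
/-- Axiom (JHS3). -/
def JHS3 : Prop :=
  JHS1 X ∧ ∀ (Δ : Set (Subobject X)) (Z W : Subobject X),
    IsPreChain Δ → IsColimSub Δ W → IsColimSub ((· ⊓ Z) '' Δ) (W ⊓ Z)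

variable (X) in
/-- Axiom (JHS4). -/
def JHS4 : Prop :=
  JHS2 X ∧ ∀ (Δ : Set (Subobject X)) (Z W : Subobject X),
    IsPreChain Δ → IsLimSub Δ W → IsLimSub ((· ⊔ Z) '' Δ) (W ⊔ Z)

variable (X) in
/-- `X` is weakly Jordan–Hölder–Schreier. -/
def WeaklyJHS : Prop :=
  JHS3 X ∧ JHS4 X

variable (X) in
/-- Axiom (JHS5): if `X ≠ 0`, every composition series of `X` has a nonempty subfactor
multiset. -/
def JHS5 : Prop :=
  ¬ IsZero X → ∀ Δ : Set (Subobject X), IsCompSeries Δ →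
    ∃ Y ∈ Δ, ∃ W, IsPred Δ Y W ∧ W ≠ Y

variable (X) in
/-- `X` is Jordan–Hölder–Schreier. -/
def IsJHS : Prop :=
  WeaklyJHS X ∧ JHS5 X

/-- The index set of the lower subfactor multiset `sf⁻(Δ)`: elements `Y ∈ Δ` admitting a
predecessor `Y⁻_Δ ≠ Y`. -/
def lowerIdx (Δ : Set (Subobject X)) : Type _ :=
  {Y : Subobject X // Y ∈ Δ ∧ ∃ W, IsPred Δ Y W ∧ W ≠ Y}

/-- The index set of the upper subfactor multiset `sf⁺(Δ)`: elements `Y ∈ Δ` admitting a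
successor `Y⁺_Δ ≠ Y`. -/
def upperIdx (Δ : Set (Subobject X)) : Type _ :=
  {Y : Subobject X // Y ∈ Δ ∧ ∃ W, IsSucc Δ Y W ∧ W ≠ Y}

/-- Subfactor equivalence of two chains: a bijection of the index sets of their subfactor
multisets under which corresponding subfactors are isomorphic. -/
def SubfactorEquiv (Δ Γ : Set (Subobject X)) : Prop :=
  ∃ e : lowerIdx Δ ≃ lowerIdx Γ,
    ∀ (Y : lowerIdx Δ) (W : Subobject X) (hW : W ≤ Y.1) (V : Subobject X)
      (hV : V ≤ (e Y).1),
      IsPred Δ Y.1 W → IsPred Γ (e Y).1 V →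
      Nonempty (quot W Y.1 hW ≅ quot V (e Y).1 hV)

/-- The lower conflation `con⁻(Δ, Γ)`. -/
def conLower (Δ Γ : Set (Subobject X)) : Set (Subobject X) :=
  Δ ∪ {V | ∃ Y ∈ Δ, ∃ Z ∈ Γ, ∃ W, IsPred Δ Y W ∧ V = W ⊔ (Y ⊓ Z)}

/-- The upper conflation `con⁺(Δ, Γ)`. -/
def conUpper (Δ Γ : Set (Subobject X)) : Set (Subobject X) :=
  Δ ∪ {V | ∃ Y ∈ Δ, ∃ Z ∈ Γ, ∃ W, IsSucc Δ Y W ∧ V = Y ⊔ (W ⊓ Z)}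

lemma IsColimSub.isLUB {Δ : Set (Subobject X)} {W : Subobject X} (h : IsColimSub Δ W) :
    IsLUB Δ W := by
  obtain ⟨hle, ⟨hc⟩⟩ := h
  refine ⟨fun Y hY => hle Y hY, fun V hV => ?_⟩
  refine Subobject.le_of_comm (hc.desc (chainCocone Δ V fun Y hY => hV hY)) (hc.hom_ext fun Y => ?_)
  have key := hc.fac (chainCocone Δ V fun Y hY => hV hY) Y
  simp only [chainCocone_ι_app] at key ⊢
  exact (Category.assoc _ _ _).symm.trans
    ((congrArg (· ≫ V.arrow) key).trans
      ((Subobject.ofLE_arrow _).trans (Subobject.ofLE_arrow _).symm))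

lemma IsLimSub.isGLB {Δ : Set (Subobject X)} (hΔ : Δ.Nonempty) {W : Subobject X}
    (h : IsLimSub Δ W) : IsGLB Δ W := by
  obtain ⟨hle, ⟨hc⟩⟩ := h
  refine ⟨fun Y hY => hle Y hY, fun V hV => ?_⟩
  obtain ⟨Y, hY⟩ := hΔ
  refine Subobject.le_of_comm (hc.lift (chainCone Δ V fun Y hY => hV hY)) ?_
  have key := hc.fac (chainCone Δ V fun Y hY => hV hY) ⟨Y, hY⟩
  simp only [chainCone_π_app] at key
  rw [← Subobject.ofLE_arrow (hle Y hY)]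
  exact (Category.assoc _ _ _).symm.trans
    ((congrArg (· ≫ Y.arrow) key).trans (Subobject.ofLE_arrow _))

lemma IsLimSub.eq_bot {W : Subobject X} (h : IsLimSub ∅ W) : W = ⊥ := by
  obtain ⟨hle, ⟨hc⟩⟩ := h
  have hid : 𝟙 (W : 𝒜) = 0 := hc.hom_ext fun Y => Y.2.elim
  refine (Subobject.mk_arrow W).symm.trans (Subobject.mk_eq_bot_iff_zero.mpr ?_)
  rw [← Category.id_comp W.arrow, hid, zero_comp]

lemma le_of_epi_ofLE {W Y : Subobject X} (h : W ≤ Y) [Epi (Subobject.ofLE W Y h)] : Y ≤ W :=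
  have : IsIso (Subobject.ofLE W Y h) := isIso_of_mono_of_epi _
  Subobject.le_of_comm (inv (Subobject.ofLE W Y h)) (by simp)

lemma eq_or_eq_of_simple_quot {W Z Y : Subobject X} (hWZ : W ≤ Z) (hZY : Z ≤ Y)
    (hs : Simple (quot W Y (hWZ.trans hZY))) : Z = W ∨ Z = Y := by
  unfold quot at hs
  set π := cokernel.π (Subobject.ofLE W Y (hWZ.trans hZY))
  by_cases h0 : Subobject.ofLE Z Y hZY ≫ π = 0
  · left
    refine le_antisymm ?_ hWZ
    refine Subobject.le_of_comm (Abelian.monoLift _ _ h0) ?_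
    rw [← Subobject.ofLE_arrow (hWZ.trans hZY), ← Category.assoc, Abelian.monoLift_comp,
      Subobject.ofLE_arrow]
  · right
    have hepi := epi_of_nonzero_to_simple h0
    have hW : Subobject.ofLE W Y (hWZ.trans hZY) ≫ cokernel.π (Subobject.ofLE Z Y hZY) = 0 := by
      rw [← Subobject.ofLE_comp_ofLE W Z Y hWZ hZY, Category.assoc, cokernel.condition, comp_zero]
    have hd : cokernel.desc _ _ hW = 0 := by
      rw [← cancel_epi (Subobject.ofLE Z Y hZY ≫ π), Category.assoc, cokernel.π_desc,
        cokernel.condition, comp_zero]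
    have hc : cokernel.π (Subobject.ofLE Z Y hZY) = 0 := by
      rw [← cokernel.π_desc _ _ hW, hd, comp_zero]
    have : Epi (Subobject.ofLE Z Y hZY) := Preadditive.epi_of_cokernel_zero hc
    exact le_antisymm hZY (le_of_epi_ofLE hZY)

lemma simple_quot_of_forall_eq_or_eq {W Y : Subobject X} (h : W ≤ Y) (hne : W ≠ Y)
    (hcov : ∀ Z, W ≤ Z → Z ≤ Y → Z = W ∨ Z = Y) : Simple (quot W Y h) := by
  unfold quot
  set π := cokernel.π (Subobject.ofLE W Y h) with hπ
  refine simple_of_cosimple _ fun {Q} q _ => ⟨fun _ hq => ?_, fun hq => ?_⟩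
  · have hπ0 : π = 0 := by
      rw [← cancel_mono q, hq, comp_zero, zero_comp]
    have : Epi (Subobject.ofLE W Y h) := Preadditive.epi_of_cokernel_zero hπ0
    exact hne (le_antisymm h (le_of_epi_ofLE h))
  · set K : Subobject X := Subobject.mk (kernel.ι (π ≫ q) ≫ Y.arrow)
    have hWK : W ≤ K := by
      refine Subobject.le_mk_of_comm
        (kernel.lift (π ≫ q) (Subobject.ofLE W Y h) ?_) ?_
      · rw [← Category.assoc, hπ, cokernel.condition, zero_comp]
      · rw [← Category.assoc, kernel.lift_ι, Subobject.ofLE_arrow]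
    have hKY : K ≤ Y := Subobject.mk_le_of_comm (kernel.ι (π ≫ q)) rfl
    rcases hcov K hWK hKY with hKW | hKY'
    · have hι : kernel.ι (π ≫ q) ≫ π = 0 := by
        have hfac : kernel.ι (π ≫ q) =
            Subobject.ofMkLE _ W hKW.le ≫ Subobject.ofLE W Y h := by
          rw [← cancel_mono Y.arrow]
          simp
        refine (congrArg (· ≫ π) hfac).trans ?_
        simp only [hπ, Category.assoc, cokernel.condition, comp_zero]
      have hs : q ≫ Abelian.epiDesc (π ≫ q) π hι = 𝟙 _ := by
        rw [← cancel_epi π, ← Category.assoc, Abelian.comp_epiDesc]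
        exact (Category.comp_id _).symm
      have : Mono q := mono_of_mono_fac hs
      exact isIso_of_mono_of_epi q
    · refine (hq ?_).elim
      have hfac : Subobject.ofLEMk Y _ hKY'.ge ≫ kernel.ι (π ≫ q) = 𝟙 _ := by
        rw [← cancel_mono Y.arrow]
        simp
      rw [← cancel_epi π, comp_zero, ← Category.id_comp (π ≫ q), ← hfac, Category.assoc,
        kernel.condition, comp_zero]

lemma IsCompSeries.mem_of_forall_comparable {Δ : Set (Subobject X)} (hΔ : IsCompSeries Δ)
    {Z : Subobject X} (hZ : ∀ Y ∈ Δ, Y ≤ Z ∨ Z ≤ Y) : Z ∈ Δ := by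
  obtain ⟨⟨-, -, htop⟩, ⟨hco, hlim⟩, hsimple⟩ := hΔ
  obtain ⟨W, hW, hWc⟩ := hco {Y | Y ∈ Δ ∧ Y ≤ Z} (Set.sep_subset _ _)
  obtain ⟨V, hV, hVl⟩ := hlim {Y | Y ∈ Δ ∧ Z ≤ Y} (Set.sep_subset _ _)
  have hWZ : W ≤ Z := hWc.isLUB.2 fun _ h => h.2
  have hVglb := IsLimSub.isGLB (Δ := {Y | Y ∈ Δ ∧ Z ≤ Y}) ⟨⊤, htop, le_top⟩ hVl
  have hZV : Z ≤ V := hVglb.2 fun _ h => h.2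
  by_cases hWV : W = V
  · rwa [le_antisymm (hZV.trans_eq hWV.symm) hWZ]
  have hlt : W < V := lt_of_le_of_ne (hWZ.trans hZV) hWV
  have hset : {Y | Y ∈ Δ ∧ Y ≤ Z} = {Y | Y ∈ Δ ∧ Y < V} := by
    ext Y
    refine ⟨fun h => ⟨h.1, (hWc.isLUB.1 h).trans_lt hlt⟩, fun h => ⟨h.1, ?_⟩⟩
    exact (hZ Y h.1).resolve_right fun hle => h.2.not_ge (hVglb.1 ⟨h.1, hle⟩)
  have hpred : IsPred Δ V W := Or.inr ⟨(bot_le.trans_lt hlt).ne', hset ▸ hWc⟩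
  rcases eq_or_eq_of_simple_quot hWZ hZV (hsimple V hV W _ hpred hWV) with rfl | rfl
  · exact hW
  · exact hV

lemma isCompSeries_of_forall_mem (h1 : JHS1 X) (h2 : JHS2 X) {Δ : Set (Subobject X)}
    (hΔ : IsPreChain Δ) (hmem : ∀ Z, (∀ Y ∈ Δ, Y ≤ Z ∨ Z ≤ Y) → Z ∈ Δ) : IsCompSeries Δ := by
  have hbot : ⊥ ∈ Δ := hmem _ fun _ _ => Or.inr bot_le
  refine ⟨⟨hΔ, hbot, hmem _ fun _ _ => Or.inl le_top⟩, ⟨fun Δ' hsub => ?_, fun Δ' hsub => ?_⟩, ?_⟩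
  · obtain ⟨W, hW⟩ := h1 Δ' (hΔ.mono hsub)
    refine ⟨W, hmem W fun Y hY => ?_, hW⟩
    by_cases hub : Y ∈ upperBounds Δ'
    · exact Or.inr (hW.isLUB.2 hub)
    · simp only [upperBounds, Set.mem_ofPred_eq, not_forall] at hub
      obtain ⟨Z, hZ, hZY⟩ := hub
      exact Or.inl (((hΔ.total hY (hsub hZ)).resolve_right hZY).trans (hW.isLUB.1 hZ))
  · obtain ⟨W, hW⟩ := h2 Δ' (hΔ.mono hsub)
    rcases Δ'.eq_empty_or_nonempty with rfl | hne
    · exact ⟨W, hW.eq_bot ▸ hbot, hW⟩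
    refine ⟨W, hmem W fun Y hY => ?_, hW⟩
    by_cases hlb : Y ∈ lowerBounds Δ'
    · exact Or.inl ((hW.isGLB hne).2 hlb)
    · simp only [lowerBounds, Set.mem_ofPred_eq, not_forall] at hlb
      obtain ⟨Z, hZ, hYZ⟩ := hlb
      exact Or.inr (((hW.isGLB hne).1 hZ).trans ((hΔ.total hY (hsub hZ)).resolve_left hYZ))
  · intro Y hY W hWY hpred hne
    rcases hpred with ⟨rfl, rfl⟩ | ⟨-, hW⟩
    · exact (hne rfl).elim
    refine simple_quot_of_forall_eq_or_eq hWY hne fun Z hWZ hZY => ?_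
    have hZ : Z ∈ Δ := hmem Z fun V hV => by
      by_cases hVY : Y ≤ V
      · exact Or.inr (hZY.trans hVY)
      · have hlt : V < Y := lt_of_le_not_ge ((hΔ.total hY hV).resolve_left hVY) hVY
        exact Or.inl ((hW.isLUB.1 ⟨hV, hlt⟩).trans hWZ)
    rcases hZY.eq_or_lt with h | h
    · exact Or.inr h
    · exact Or.inl (le_antisymm (hW.isLUB.1 ⟨hZ, h⟩) hWZ)

lemma isCompSeries_iff_forall_eq (h1 : JHS1 X) (h2 : JHS2 X) {Δ : Set (Subobject X)}
    (hΔ : IsPreChain Δ) :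
    IsCompSeries Δ ↔ ∀ Δ' : Set (Subobject X), IsPreChain Δ' → Δ ⊆ Δ' → Δ = Δ' := by
  refine ⟨fun h Δ' hΔ' hsub => ?_, fun h => isCompSeries_of_forall_mem h1 h2 hΔ fun Z hZ => ?_⟩
  · exact hsub.antisymm fun Z hZ =>
      h.mem_of_forall_comparable fun Y hY => hΔ'.total (hsub hY) hZ
  · rw [h (insert Z Δ) (hΔ.insert fun Y hY _ => (hZ Y hY).symm) (Set.subset_insert Z Δ)]
    exact Set.mem_insert Z Δ

lemma exists_isCompSeries_superset (h1 : JHS1 X) (h2 : JHS2 X) {Δ : Set (Subobject X)}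
    (hΔ : IsPreChain Δ) : ∃ Δ' : Set (Subobject X), IsCompSeries Δ' ∧ Δ ⊆ Δ' := by
  obtain ⟨Δ', hmax, hsub⟩ := hΔ.exists_maxChain
  exact ⟨Δ', (isCompSeries_iff_forall_eq h1 h2 hmax.1).2 fun _ h hle => hmax.2 h hle, hsub⟩

/-- Theorem 3.15 (Theorem 1.2): existence of composition series for subobject bicomplete
objects, maximality characterization, and refinement to a composition series. -/
theorem statement0 [EssentiallySmall.{w} 𝒜] (X : 𝒜) (h1 : JHS1 X) (h2 : JHS2 X) :
    (∃ Δ : Set (Subobject X), IsCompSeries Δ) ∧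
    ∀ Δ : Set (Subobject X), IsPreChain Δ →
      ((IsCompSeries Δ ↔
          ∀ Δ' : Set (Subobject X), IsPreChain Δ' → Δ ⊆ Δ' → Δ = Δ') ∧
        ∃ Δ' : Set (Subobject X), IsCompSeries Δ' ∧ Δ ⊆ Δ') := by
  obtain ⟨Δ₀, hΔ₀, -⟩ := exists_isCompSeries_superset h1 h2 (Δ := (∅ : Set (Subobject X)))
    (Set.pairwise_empty _)
  exact ⟨⟨Δ₀, hΔ₀⟩, fun Δ hΔ =>
    ⟨isCompSeries_iff_forall_eq h1 h2 hΔ, exists_isCompSeries_superset h1 h2 hΔ⟩⟩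

end JHS
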